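/- Set I₀ := identity, I₁ := L_i, I₂ := L_j, I₃ := L_k (each extended ℂ-linearly to ℍ⊗ℂ), and let π_{ν⁺} and π_{ξ⁻} denote the orthogonal projections of ℍ⊗ℂ onto ν⁺ and ξ⁻ with respect to the Hermitian inner product. Then for every v ∈ η: ∑_{j=0}^{3} ‖π_{ν⁺}(I_j v)‖² = ∑_{j=0}^{3} ‖π_{ξ⁻}(I_j v)‖² = 2‖v‖². -/

import Mathlib

open scoped Quaternion RealInnerProductSpace

/-- Averaging over the standard basis of the quaternions: for purely imaginary `u`, the inner
products `⟪e a, u e b⟫` for `e = 1, i, j, k` sum to zero. -/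
theorem sum_inner_mul_basis_eq_zero {u : ℍ[ℝ]} (hu : u.re = 0) (a b : ℍ[ℝ]) :
    ∑ j : Fin 4, ⟪(![1, ⟨0, 1, 0, 0⟩, ⟨0, 0, 1, 0⟩, ⟨0, 0, 0, 1⟩] : Fin 4 → ℍ[ℝ]) j * a,
      u * ((![1, ⟨0, 1, 0, 0⟩, ⟨0, 0, 1, 0⟩, ⟨0, 0, 0, 1⟩] : Fin 4 → ℍ[ℝ]) j * b)⟫ = 0 := by
  simp [Fin.sum_univ_four, Quaternion.inner_def, hu]
  ring

/-- The standard basis `1, i, j, k` of the quaternions consists of unit vectors. -/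
theorem norm_basis_eq_one (j : Fin 4) :
    ‖(![1, ⟨0, 1, 0, 0⟩, ⟨0, 0, 1, 0⟩, ⟨0, 0, 0, 1⟩] : Fin 4 → ℍ[ℝ]) j‖ = 1 := by
  rw [← sq_eq_sq₀ (norm_nonneg _) zero_le_one, sq, ← Quaternion.normSq_eq_norm_mul_self,
    Quaternion.normSq_def']
  fin_cases j <;> simp

/-- If `x + i y = s + t` with `s`, `t` in the `i`- and `-i`-eigenspaces of left multiplication by a
unit quaternion `u`, then the norms of `s` and `t` are determined by `x` and `y`. -/
theorem norm_sq_eigencomponents {u x y : ℍ[ℝ]} (hu : ‖u‖ = 1) {s t : ℍ[ℝ] × ℍ[ℝ]}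
    (hs : u * s.2 = s.1) (ht : u * t.2 = -t.1) (h : (x, y) = s + t) :
    ‖s.1‖ ^ 2 + ‖s.2‖ ^ 2 = (‖x‖ ^ 2 + ‖y‖ ^ 2) / 2 + ⟪x, u * y⟫ ∧
    ‖t.1‖ ^ 2 + ‖t.2‖ ^ 2 = (‖x‖ ^ 2 + ‖y‖ ^ 2) / 2 - ⟪x, u * y⟫ := by
  obtain ⟨hx, hy⟩ := Prod.ext_iff.mp h
  simp only [Prod.fst_add, Prod.snd_add] at hx hy
  have hs_norm : ‖s.2‖ = ‖s.1‖ := by rw [← hs, norm_mul, hu, one_mul]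
  have ht_norm : ‖t.2‖ = ‖t.1‖ := by rw [← norm_neg t.1, ← ht, norm_mul, hu, one_mul]
  have huy : u * y = s.1 - t.1 := by rw [hy, mul_add, hs, ht, sub_eq_add_neg]
  have hy_norm : ‖y‖ = ‖s.1 - t.1‖ := by rw [← huy, norm_mul, hu, one_mul]
  rw [hs_norm, ht_norm, hy_norm, huy, hx, norm_add_sq_real, norm_sub_sq_real, inner_add_left,
    inner_sub_right, inner_sub_right, real_inner_self_eq_norm_sq, real_inner_self_eq_norm_sq,
    real_inner_comm s.1 t.1]
  constructor <;> ring

/-- Model `ℍ ⊗ ℂ` as pairs `(a, b)` of quaternions representing `a + ib`, with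
the Hermitian norm `‖(a,b)‖² = ‖a‖² + ‖b‖²`.  Let `I₀ := id = L_1`,
`I₁ := L_i`, `I₂ := L_j`, `I₃ := L_k` (extended complex-linearly, i.e.
componentwise) and let `ν⁺, ξ⁻, η := ν⁺ ⊕ ξ⁻` be as in the paper.  Since each
`I_j` maps `η` into itself, for `v ∈ η` the element `I_j v` decomposes as
`I_j v = s_j + σ_j` with `s_j ∈ ν⁺` and `σ_j ∈ ξ⁻`; these are the orthogonal
projections of `I_j v` to `ν⁺` and `ξ⁻`.  Then
`∑_j ‖s_j‖² = ∑_j ‖σ_j‖² = 2‖v‖²`. -/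
theorem sum_norm_sq_projections
    (u : ℍ[ℝ]) (hu_im : u.re = 0) (hu_unit : ‖u‖ = 1)
    (ξ ν : Submodule ℝ ℍ[ℝ])
    (hξdim : Module.finrank ℝ ξ = 2) (hνdim : Module.finrank ℝ ν = 2)
    (horth : ∀ x ∈ ξ, ∀ y ∈ ν, ⟪x, y⟫ = 0)
    (hcompl : IsCompl ξ ν)
    (hJξ : ∀ x ∈ ξ, u * x ∈ ξ) (hJν : ∀ y ∈ ν, u * y ∈ ν)
    (νp ξm η : Set (ℍ[ℝ] × ℍ[ℝ]))
    (hνp : νp = {p : ℍ[ℝ] × ℍ[ℝ] |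
      p.1 ∈ ν ∧ p.2 ∈ ν ∧ u * p.1 = -p.2 ∧ u * p.2 = p.1})
    (hξm : ξm = {p : ℍ[ℝ] × ℍ[ℝ] |
      p.1 ∈ ξ ∧ p.2 ∈ ξ ∧ u * p.1 = p.2 ∧ u * p.2 = -p.1})
    (hη : η = {v : ℍ[ℝ] × ℍ[ℝ] | ∃ s ∈ νp, ∃ w ∈ ξm, v = s + w})
    -- the quaternions 1, i, j, k
    (q : Fin 4 → ℍ[ℝ])
    (hq : q = ![1, ⟨0, 1, 0, 0⟩, ⟨0, 0, 1, 0⟩, ⟨0, 0, 0, 1⟩])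
    (v : ℍ[ℝ] × ℍ[ℝ]) (hv : v ∈ η)
    (s σ' : Fin 4 → ℍ[ℝ] × ℍ[ℝ])
    (hs : ∀ j, s j ∈ νp) (hσ' : ∀ j, σ' j ∈ ξm)
    -- `I_j v = s_j + σ_j`
    (hdec : ∀ j : Fin 4, ((q j * v.1, q j * v.2) : ℍ[ℝ] × ℍ[ℝ]) = s j + σ' j) :
    (∑ j : Fin 4, (‖(s j).1‖ ^ 2 + ‖(s j).2‖ ^ 2)
        = 2 * (‖v.1‖ ^ 2 + ‖v.2‖ ^ 2)) ∧
    (∑ j : Fin 4, (‖(σ' j).1‖ ^ 2 + ‖(σ' j).2‖ ^ 2)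
        = 2 * (‖v.1‖ ^ 2 + ‖v.2‖ ^ 2)) := by
  subst hνp hξm hq
  have key j := norm_sq_eigencomponents hu_unit (hs j).2.2.2 (hσ' j).2.2.2 (hdec j)
  simp only [norm_mul, norm_basis_eq_one, one_mul] at key
  have hsum := sum_inner_mul_basis_eq_zero hu_im v.1 v.2
  constructor
  · rw [Finset.sum_congr rfl fun j _ => (key j).1, Finset.sum_add_distrib, hsum, Finset.sum_const,
      Finset.card_univ, Fintype.card_fin, nsmul_eq_mul]
    push_cast
    ring
  · rw [Finset.sum_congr rfl fun j _ => (key j).2, Finset.sum_sub_distrib, hsum, Finset.sum_const,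
      Finset.card_univ, Fintype.card_fin, nsmul_eq_mul]
    push_cast
    ring
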